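/- For every t > 0, the identity t² ∫_0^1 (1−z)² (1 − e^{−tz}) / z dz + 1 − t + (3/4) t² − e^{−t} = t² ln t + t² (γ − 3/4 + E₁(t)) + t (1 − e^{−t}) holds, where γ is the Euler–Mascheroni constant and E₁(t) = ∫_t^∞ s^{-1} e^{−s} ds. (Both sides equal the variance Var Σ₀(t) of the sum of the spherical intrinsic volumes V₀ over all cells of an isotropic splitting tessellation on S² with time parameter t.) -/

import Mathlib

open MeasureTheory Real

/-- The exponential integral `E₁(t) = ∫_t^∞ s⁻¹ e^{-s} ds`. -/
noncomputable def expIntegralE1 (t : ℝ) : ℝ := ∫ s in Set.Ioi t, s⁻¹ * Real.exp (-s)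

section

open Set Filter Topology

/-- The entire extension of `s ↦ (1 - e^{-s}) / s`. -/
noncomputable def oneSubExpNegDiv : ℝ → ℝ := dslope (fun s => 1 - Real.exp (-s)) 0

lemma mul_oneSubExpNegDiv (s : ℝ) : s * oneSubExpNegDiv s = 1 - Real.exp (-s) := by
  simpa [oneSubExpNegDiv] using sub_smul_dslope (fun s : ℝ => 1 - Real.exp (-s)) 0 s

lemma continuous_oneSubExpNegDiv : Continuous oneSubExpNegDiv := by
  rw [← continuousOn_univ]
  refine (continuousOn_dslope univ_mem).2 ⟨by fun_prop, by fun_prop⟩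

lemma integrableOn_inv_mul_exp_neg {t : ℝ} (ht : 0 < t) :
    IntegrableOn (fun s : ℝ => s⁻¹ * Real.exp (-s)) (Ioi t) := by
  refine ((integrableOn_exp_neg_Ioi t).const_mul t⁻¹).mono'
    (by fun_prop) ?_
  filter_upwards [ae_restrict_mem measurableSet_Ioi] with s hs
  have hs : t < s := hs
  have hs0 : 0 < s := ht.trans hs
  rw [Real.norm_of_nonneg (by positivity)]
  gcongr

lemma integrableOn_log_mul_exp_neg {t : ℝ} (ht : 0 < t) :
    IntegrableOn (fun s : ℝ => Real.log s * Real.exp (-s)) (Ioi t) := by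
  have h2 : IntegrableOn (fun s : ℝ => Real.exp (-s) * s) (Ioi t) := by
    have h := Real.GammaIntegral_convergent (s := 2) (by norm_num)
    refine (h.mono_set (Ioi_subset_Ioi ht.le)).congr_fun (fun s _ => ?_) measurableSet_Ioi
    norm_num
  refine (h2.add ((integrableOn_exp_neg_Ioi t).const_mul t⁻¹)).mono' (by fun_prop) ?_
  filter_upwards [ae_restrict_mem measurableSet_Ioi] with s hs
  have hs : t < s := hs
  have hs0 : 0 < s := ht.trans hs
  have h1 := Real.log_le_sub_one_of_pos hs0
  have h3 := Real.one_sub_inv_le_log_of_pos hs0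
  have h4 : s⁻¹ ≤ t⁻¹ := by gcongr
  have h5 : 0 < t⁻¹ := by positivity
  have h6 : |Real.log s| ≤ s + t⁻¹ := abs_le.2 ⟨by linarith, by linarith⟩
  rw [Real.norm_eq_abs, abs_mul, Real.abs_exp]
  simp only [Pi.add_apply]
  calc _ ≤ (s + t⁻¹) * Real.exp (-s) := by gcongr
    _ = _ := by ring

lemma integral_Ioi_log_mul_exp_neg {t : ℝ} (ht : 0 < t) :
    ∫ s in Ioi t, Real.log s * Real.exp (-s) =
      Real.log t * Real.exp (-t) + expIntegralE1 t := by
  have hderiv : ∀ s ∈ Ici t, HasDerivAt (fun s : ℝ => Real.log s * Real.exp (-s))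
      (s⁻¹ * Real.exp (-s) - Real.log s * Real.exp (-s)) s := fun s hs => by
    have hs0 : s ≠ 0 := (ht.trans_le hs).ne'
    refine ((Real.hasDerivAt_log hs0).mul (hasDerivAt_neg s).exp).congr_deriv ?_
    ring
  have hlim : Tendsto (fun s : ℝ => Real.log s * Real.exp (-s)) atTop (𝓝 0) := by
    refine squeeze_zero' ?_ ?_ (Real.tendsto_pow_mul_exp_neg_atTop_nhds_zero 1)
    · filter_upwards [eventually_ge_atTop 1] with s hs
      exact mul_nonneg (Real.log_nonneg hs) (Real.exp_pos _).le
    · filter_upwards [eventually_ge_atTop 1] with s hs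
      rw [pow_one]
      gcongr
      exact Real.log_le_self (by linarith)
  have h := integral_Ioi_of_hasDerivAt_of_tendsto' hderiv
    ((integrableOn_inv_mul_exp_neg ht).sub (integrableOn_log_mul_exp_neg ht)) hlim
  rw [integral_sub (integrableOn_inv_mul_exp_neg ht) (integrableOn_log_mul_exp_neg ht)] at h
  rw [expIntegralE1]
  linarith

lemma intervalIntegrable_log_mul_exp_neg (t : ℝ) :
    IntervalIntegrable (fun s : ℝ => Real.log s * Real.exp (-s)) volume 0 t :=
  intervalIntegral.intervalIntegrable_log'.mul_continuousOn
    (by fun_prop : Continuous fun s : ℝ => Real.exp (-s)).continuousOn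

lemma integral_log_mul_exp_neg {t : ℝ} (ht : 0 < t) :
    ∫ s in (0:ℝ)..t, Real.log s * Real.exp (-s) =
      Real.log t * (1 - Real.exp (-t)) - ∫ s in (0:ℝ)..t, oneSubExpNegDiv s := by
  have hD := continuous_oneSubExpNegDiv.intervalIntegrable (μ := volume) 0 t
  have hcont : Continuous fun s : ℝ => Real.log s * (1 - Real.exp (-s)) := by
    refine (Real.continuous_mul_log.mul continuous_oneSubExpNegDiv).congr fun s => ?_
    simp only [← mul_oneSubExpNegDiv, Pi.mul_apply]
    ring
  have h := intervalIntegral.integral_eq_sub_of_hasDerivAt_of_le ht.le hcont.continuousOn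
    (f' := fun s => Real.log s * Real.exp (-s) + oneSubExpNegDiv s) (fun s hs => by
      have hs0 : s ≠ 0 := hs.1.ne'
      refine ((Real.hasDerivAt_log hs0).mul ((hasDerivAt_neg s).exp.const_sub 1)).congr_deriv ?_
      rw [← mul_oneSubExpNegDiv]
      field_simp
      ring) ((intervalIntegrable_log_mul_exp_neg t).add hD)
  rw [intervalIntegral.integral_add (intervalIntegrable_log_mul_exp_neg t) hD] at h
  simp only [Real.log_zero, zero_mul, sub_zero] at h
  linarith

lemma integral_Ioi_zero_log_mul_exp_neg :
    ∫ s in Ioi (0:ℝ), Real.log s * Real.exp (-s) = -Real.eulerMascheroniConstant := by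
  have h1 := Complex.hasDerivAt_GammaIntegral (s := 1) (by simp)
  have h2 : HasDerivAt Complex.GammaIntegral (-(Real.eulerMascheroniConstant : ℂ)) 1 := by
    refine Complex.hasDerivAt_Gamma_one.congr_of_eventuallyEq ?_
    have ho : IsOpen {z : ℂ | 0 < z.re} := isOpen_lt continuous_const Complex.continuous_re
    filter_upwards [ho.mem_nhds (show (1 : ℂ) ∈ {z : ℂ | 0 < z.re} by simp)] with z hz
    exact (Complex.Gamma_eq_integral hz).symm
  have h3 := h1.unique h2
  simp only [sub_self, Complex.cpow_zero, one_mul, ← Complex.ofReal_mul] at h3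
  rw [integral_complex_ofReal] at h3
  exact_mod_cast h3

/-- The entire exponential integral satisfies `Ein(t) = ln t + γ + E₁(t)`. -/
lemma integral_oneSubExpNegDiv {t : ℝ} (ht : 0 < t) :
    ∫ s in (0:ℝ)..t, oneSubExpNegDiv s =
      Real.log t + Real.eulerMascheroniConstant + expIntegralE1 t := by
  have h := intervalIntegral.integral_interval_add_Ioi'
    (intervalIntegrable_log_mul_exp_neg t) (integrableOn_log_mul_exp_neg ht)
  rw [integral_log_mul_exp_neg ht, integral_Ioi_log_mul_exp_neg ht,
    integral_Ioi_zero_log_mul_exp_neg] at h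
  linarith

lemma integral_sub_two_mul_one_sub_exp {t : ℝ} (ht : t ≠ 0) :
    ∫ z in (0:ℝ)..1, (z - 2) * (1 - Real.exp (-(t * z))) =
      -3 / 2 + 2 * (1 - Real.exp (-t)) / t + ((t + 1) * Real.exp (-t) - 1) / t ^ 2 := by
  have hderiv : ∀ z ∈ uIcc (0:ℝ) 1, HasDerivAt
      (fun z : ℝ => z ^ 2 / 2 - 2 * z + ((z - 2) / t + 1 / t ^ 2) * Real.exp (-(t * z)))
      ((z - 2) * (1 - Real.exp (-(t * z)))) z := fun z _ => by
    have he : HasDerivAt (fun z : ℝ => Real.exp (-(t * z)))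
        (Real.exp (-(t * z)) * -(t * 1)) z := ((hasDerivAt_id z).const_mul t).neg.exp
    have hp : HasDerivAt (fun z : ℝ => z ^ 2 / 2 - 2 * z) (z - 2) z := by
      refine (((hasDerivAt_pow 2 z).div_const 2).sub ((hasDerivAt_id z).const_mul 2)).congr_deriv ?_
      simp
    have hq : HasDerivAt (fun z : ℝ => (z - 2) / t + 1 / t ^ 2) (1 / t) z :=
      (((hasDerivAt_id z).sub_const 2).div_const t).add_const _
    refine (hp.add (hq.mul he)).congr_deriv ?_
    field_simp
    ring
  rw [intervalIntegral.integral_eq_sub_of_hasDerivAt hderiv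
    ((by fun_prop : Continuous _).intervalIntegrable _ _)]
  simp only [mul_one, mul_zero, neg_zero, Real.exp_zero]
  field_simp
  ring

lemma integral_one_sub_sq_mul_one_sub_exp_div {t : ℝ} (ht : 0 < t) :
    ∫ z in (0:ℝ)..1, (1 - z) ^ 2 * (1 - Real.exp (-(t * z))) / z =
      (∫ s in (0:ℝ)..t, oneSubExpNegDiv s)
        + ∫ z in (0:ℝ)..1, (z - 2) * (1 - Real.exp (-(t * z))) := by
  have hscale : ∫ s in (0:ℝ)..t, oneSubExpNegDiv s =
      ∫ z in (0:ℝ)..1, t * oneSubExpNegDiv (t * z) := by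
    rw [intervalIntegral.integral_const_mul, intervalIntegral.mul_integral_comp_mul_left]
    simp
  have hD : Continuous fun z => t * oneSubExpNegDiv (t * z) :=
    continuous_const.mul (continuous_oneSubExpNegDiv.comp (by fun_prop))
  rw [hscale, ← intervalIntegral.integral_add (hD.intervalIntegrable _ _)
    ((by fun_prop : Continuous _).intervalIntegrable _ _)]
  refine intervalIntegral.integral_congr_ae (Eventually.of_forall fun z hz => ?_)
  rw [uIoc_of_le zero_le_one] at hz
  have hz0 : z ≠ 0 := hz.1.ne'
  rw [← mul_oneSubExpNegDiv]
  field_simp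
  ring

end

/-- For every `t > 0`,
`t² ∫_0^1 (1-z)²(1-e^{-tz})/z dz + 1 - t + (3/4)t² - e^{-t}
  = t² ln t + t²(γ - 3/4 + E₁(t)) + t(1 - e^{-t})`;
both sides equal the variance `Var Σ₀(t)` for an isotropic splitting tessellation on `S²`. -/
theorem varSigma0_identity (t : ℝ) (ht : 0 < t) :
    t ^ 2 * (∫ z in (0:ℝ)..1, (1 - z) ^ 2 * (1 - Real.exp (-(t * z))) / z)
        + 1 - t + (3 / 4) * t ^ 2 - Real.exp (-t)
      = t ^ 2 * Real.log t
        + t ^ 2 * (Real.eulerMascheroniConstant - 3 / 4 + expIntegralE1 t)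
        + t * (1 - Real.exp (-t)) := by
  rw [integral_one_sub_sq_mul_one_sub_exp_div ht, integral_oneSubExpNegDiv ht,
    integral_sub_two_mul_one_sub_exp ht.ne']
  field_simp
  ring
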